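/- Let X be a real normed space and let f₁, f₂ : X → ℝ ∪ {+∞} both be LĈ-subdifferentiable at a point x̄ with f₁(x̄) and f₂(x̄) finite. Then f₁ + f₂ is LĈ-subdifferentiable at x̄ and: (i) if l₁ ∈ D_{LĈθ}f₁(x̄) and l₂ ∈ D_{LĈθ}f₂(x̄), then l₁ + l₂ ∈ D_{LĈθ}(f₁ + f₂)(x̄); (ii) for any l₁ ∈ ∂_{LĈθ}f₁(x̄) and any l₂ ∈ ∂_{LĈθ}f₂(x̄) there exists l ∈ ∂_{LĈθ}(f₁ + f₂)(x̄) such that l(x) ≥ l₁(x) + l₂(x) for all x ∈ X. -/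

import Mathlib

/-- A concave function with a `k`-Lipschitz minorant is itself `k`-Lipschitz. -/
theorem ConcaveOn.abs_sub_le_of_lipschitz_minorant {X : Type*} [NormedAddCommGroup X]
    [NormedSpace ℝ X] {l m : X → ℝ} {k : ℝ} (hm : ConcaveOn ℝ Set.univ m)
    (hl : ∀ x y, |l x - l y| ≤ k * ‖x - y‖) (hlm : l ≤ m) (x y : X) :
    |m x - m y| ≤ k * ‖x - y‖ := by
  have one_sided : ∀ x y, m x - m y ≤ k * ‖x - y‖ := by
    intro x y
    by_contra! hlt
    set δ := m x - m y - k * ‖x - y‖ with hδ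
    have hδpos : 0 < δ := by linarith
    set A := m x - l x with hA
    have hA0 : 0 ≤ A := sub_nonneg.2 (hlm x)
    set s := δ / (A + δ) with hs
    have hspos : 0 < s := by positivity
    have hs1 : s ≤ 1 := (div_le_one (by positivity)).2 (by linarith)
    have hsA : s * A < δ := by
      rw [hs, div_mul_eq_mul_div, div_lt_iff₀ (by positivity)]
      nlinarith
    set z := x + s⁻¹ • (y - x) with hz
    have hconc := hm.2 (Set.mem_univ x) (Set.mem_univ z) (sub_nonneg.2 hs1) hspos.le
      (sub_add_cancel 1 s)
    have hcomb : (1 - s) • x + s • z = y := by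
      rw [hz, smul_add, smul_inv_smul₀ hspos.ne', sub_smul, one_smul]
      abel
    rw [hcomb, smul_eq_mul, smul_eq_mul] at hconc
    have hnorm : s * ‖x - z‖ = ‖x - y‖ := by
      have hxz : x - z = s⁻¹ • (x - y) := by
        rw [hz, ← neg_sub x y, smul_neg]
        abel
      rw [hxz, norm_smul, Real.norm_of_nonneg (by positivity), mul_inv_cancel_left₀ hspos.ne']
    have hlz : s * (l x - l z) ≤ k * ‖x - y‖ := by
      calc s * (l x - l z) ≤ s * (k * ‖x - z‖) :=
            mul_le_mul_of_nonneg_left ((le_abs_self _).trans (hl x z)) hspos.le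
        _ = k * ‖x - y‖ := by rw [← hnorm]; ring
    have hmz : s * l z ≤ s * m z := mul_le_mul_of_nonneg_left (hlm z) hspos.le
    have hsA' : s * A = s * m x - s * l x := by rw [hA]; ring
    linarith
  exact abs_le.2 ⟨by linarith [norm_sub_rev x y ▸ one_sided y x], one_sided x y⟩

/-- The pointwise supremum of a chain of concave functions is concave. -/
theorem IsChain.concaveOn_iSup {X : Type*} [AddCommGroup X] [Module ℝ X] {c : Set (X → ℝ)}
    (hc : IsChain (· ≤ ·) c) (hne : c.Nonempty) (hconc : ∀ m ∈ c, ConcaveOn ℝ Set.univ m)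
    (hbdd : ∀ x, BddAbove (Set.range fun m : c => m.1 x)) :
    ConcaveOn ℝ Set.univ fun x => ⨆ m : c, m.1 x := by
  have : Nonempty c := hne.to_subtype
  refine ⟨convex_univ, fun x _ y _ a b ha hb hab => ?_⟩
  simp only [smul_eq_mul]
  rw [Real.mul_iSup_of_nonneg ha, Real.mul_iSup_of_nonneg hb]
  refine ciSup_add_ciSup_le fun p q => ?_
  obtain ⟨r, hr, hpr, hqr⟩ := hc.directedOn p.1 p.2 q.1 q.2
  calc a * p.1 x + b * q.1 y ≤ a * r x + b * r y :=
        add_le_add (mul_le_mul_of_nonneg_left (hpr x) ha) (mul_le_mul_of_nonneg_left (hqr y) hb)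
    _ ≤ r (a • x + b • y) := (hconc r hr).2 (Set.mem_univ x) (Set.mem_univ y) ha hb hab
    _ ≤ _ := le_ciSup (hbdd (a • x + b • y)) ⟨r, hr⟩

/-- A concave Lipschitz function vanishing at `0` and bounded above by `u` lies below a maximal
such function. -/
theorem exists_maximal_concave_lipschitz {X : Type*} [NormedAddCommGroup X] [NormedSpace ℝ X]
    (u : X → EReal) {l : X → ℝ} {k : ℝ} (hconc : ConcaveOn ℝ Set.univ l)
    (hlip : ∀ x y, |l x - l y| ≤ k * ‖x - y‖) (hl0 : l 0 = 0) (hlu : ∀ x, (l x : EReal) ≤ u x) :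
    ∃ m, l ≤ m ∧ ConcaveOn ℝ Set.univ m ∧ (∀ x y, |m x - m y| ≤ k * ‖x - y‖) ∧ m 0 = 0 ∧
      (∀ x, (m x : EReal) ≤ u x) ∧
      ∀ n : X → ℝ, ConcaveOn ℝ Set.univ n → n 0 = 0 → (∀ x, (n x : EReal) ≤ u x) →
        m ≤ n → n = m := by
  obtain ⟨m, hlm, hm⟩ := zorn_le_nonempty₀
    {m : X → ℝ | l ≤ m ∧ ConcaveOn ℝ Set.univ m ∧ m 0 = 0 ∧ ∀ x, (m x : EReal) ≤ u x}
    (fun c hcs hc y hy => by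
      have : Nonempty c := ⟨⟨y, hy⟩⟩
      have hbdd : ∀ x, BddAbove (Set.range fun m : c => m.1 x) := by
        refine fun x => ⟨k * ‖x‖, ?_⟩
        rintro _ ⟨m, rfl⟩
        obtain ⟨hlm, hmc, hm0, -⟩ := hcs m.2
        have := hmc.abs_sub_le_of_lipschitz_minorant hlip hlm x 0
        rw [hm0, sub_zero, sub_zero] at this
        exact (le_abs_self _).trans this
      refine ⟨fun x => ⨆ m : c, m.1 x, ⟨fun x => ?_, ?_, ?_, fun x => ?_⟩,
        fun m hm x => le_ciSup (hbdd x) ⟨m, hm⟩⟩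
      · exact ((hcs hy).1 x).trans (le_ciSup (hbdd x) ⟨y, hy⟩)
      · exact hc.concaveOn_iSup ⟨y, hy⟩ (fun m hm => (hcs hm).2.1) hbdd
      · have : ∀ m : c, m.1 0 = 0 := fun m => (hcs m.2).2.2.1
        simp [this]
      · have hle : ∀ m : c, (m.1 x : EReal) ≤ u x := fun m => (hcs m.2).2.2.2 x
        induction hux : u x with
        | bot => simpa [hux] using hle ⟨y, hy⟩
        | top => exact le_top
        | coe r =>
          rw [EReal.coe_le_coe_iff]
          exact ciSup_le fun m => by simpa [hux] using hle m)
    l ⟨le_rfl, hconc, hl0, hlu⟩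
  obtain ⟨-, hmc, hm0, hmu⟩ := hm.prop
  exact ⟨m, hlm, hmc, hmc.abs_sub_le_of_lipschitz_minorant hlip hlm, hm0, hmu,
    fun n hn hn0 hnu hmn => (hm.eq_of_le ⟨hlm.trans hmn, hn, hn0, hnu⟩ hmn).symm⟩

/-- If `f₁, f₂ : X → ℝ ∪ {+∞}` are both `LĈ`-subdifferentiable at `x₀`
(with finite values there), then `f₁ + f₂` is `LĈ`-subdifferentiable at `x₀`;
(i) subgradients add: `l₁ ∈ D_{LĈθ}f₁(x₀)` and `l₂ ∈ D_{LĈθ}f₂(x₀)` imply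
`l₁ + l₂ ∈ D_{LĈθ}(f₁ + f₂)(x₀)`; (ii) for any maximal subgradients `l₁ ∈ ∂_{LĈθ}f₁(x₀)`,
`l₂ ∈ ∂_{LĈθ}f₂(x₀)` there exists `l ∈ ∂_{LĈθ}(f₁ + f₂)(x₀)` with `l ≥ l₁ + l₂`. -/
theorem statement16 {X : Type*} [NormedAddCommGroup X] [NormedSpace ℝ X]
    (f₁ f₂ : X → EReal) (h₁bot : ∀ x, f₁ x ≠ ⊥) (h₂bot : ∀ x, f₂ x ≠ ⊥)
    (x₀ : X) (h₁top : f₁ x₀ ≠ ⊤) (h₂top : f₂ x₀ ≠ ⊤)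
    (LC : Set (X → ℝ))
    (hLC : LC = {h : X → ℝ | ConcaveOn ℝ Set.univ h ∧
        ∃ k : ℝ, 0 ≤ k ∧ ∀ x y : X, |h x - h y| ≤ k * ‖x - y‖})
    (hsub₁ : ∃ h ∈ LC, (∀ x, (h x : EReal) ≤ f₁ x) ∧ (h x₀ : EReal) = f₁ x₀)
    (hsub₂ : ∃ h ∈ LC, (∀ x, (h x : EReal) ≤ f₂ x) ∧ (h x₀ : EReal) = f₂ x₀)
    (D : (X → EReal) → Set (X → ℝ))
    (hD : ∀ g : X → EReal, D g = {l : X → ℝ | l ∈ LC ∧ l 0 = 0 ∧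
        ∀ x, (l (x - x₀) : EReal) + g x₀ ≤ g x})
    (P : (X → EReal) → Set (X → ℝ))
    (hP : ∀ g : X → EReal, P g = {l ∈ D g | ∀ m ∈ D g, l ≤ m → m = l}) :
    (∃ h ∈ LC, (∀ x, (h x : EReal) ≤ f₁ x + f₂ x) ∧
      (h x₀ : EReal) = f₁ x₀ + f₂ x₀) ∧
    (∀ l₁ ∈ D f₁, ∀ l₂ ∈ D f₂,
      (fun x => l₁ x + l₂ x) ∈ D (fun x => f₁ x + f₂ x)) ∧
    (∀ l₁ ∈ P f₁, ∀ l₂ ∈ P f₂, ∃ l ∈ P (fun x => f₁ x + f₂ x),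
      ∀ x, l₁ x + l₂ x ≤ l x) := by
  have LC_add : ∀ p ∈ LC, ∀ q ∈ LC, (fun x => p x + q x) ∈ LC := by
    subst hLC
    rintro p ⟨hp, k, hk, hpk⟩ q ⟨hq, j, hj, hqj⟩
    refine ⟨hp.add hq, k + j, add_nonneg hk hj, fun x y => ?_⟩
    calc |p x + q x - (p y + q y)| = |(p x - p y) + (q x - q y)| := by ring_nf
      _ ≤ |p x - p y| + |q x - q y| := abs_add_le _ _
      _ ≤ (k + j) * ‖x - y‖ := by linarith [hpk x y, hqj x y]
  have D_add : ∀ l₁ ∈ D f₁, ∀ l₂ ∈ D f₂,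
      (fun x => l₁ x + l₂ x) ∈ D (fun x => f₁ x + f₂ x) := by
    simp only [hD]
    rintro p ⟨hp, hp0, hpf⟩ q ⟨hq, hq0, hqf⟩
    refine ⟨LC_add p hp q hq, by simp [hp0, hq0], fun x => ?_⟩
    rw [EReal.coe_add, add_add_add_comm]
    exact add_le_add (hpf x) (hqf x)
  refine ⟨?_, D_add, fun l₁ hl₁ l₂ hl₂ => ?_⟩
  · obtain ⟨p, hp, hpf, hp0⟩ := hsub₁
    obtain ⟨q, hq, hqf, hq0⟩ := hsub₂
    refine ⟨_, LC_add p hp q hq, fun x => ?_, ?_⟩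
    · rw [EReal.coe_add]
      exact add_le_add (hpf x) (hqf x)
    · rw [EReal.coe_add, hp0, hq0]
  · rw [hP] at hl₁ hl₂
    have hl := D_add l₁ hl₁.1 l₂ hl₂.1
    obtain ⟨r, hr⟩ : ∃ r : ℝ, f₁ x₀ + f₂ x₀ = (r : EReal) :=
      ⟨(f₁ x₀).toReal + (f₂ x₀).toReal, by
        rw [EReal.coe_add, EReal.coe_toReal h₁top (h₁bot x₀),
          EReal.coe_toReal h₂top (h₂bot x₀)]⟩
    have hiff : ∀ l : X → ℝ, (∀ x, (l (x - x₀) : EReal) + (f₁ x₀ + f₂ x₀) ≤ f₁ x + f₂ x) ↔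
        ∀ x, (l x : EReal) ≤ f₁ (x + x₀) + f₂ (x + x₀) - r := by
      intro l
      rw [hr, ← (Equiv.subRight x₀).forall_congr_right (q := fun x =>
        (l x : EReal) ≤ f₁ (x + x₀) + f₂ (x + x₀) - r)]
      refine forall_congr' fun x => ?_
      simp only [Equiv.subRight_apply, sub_add_cancel]
      exact (EReal.le_sub_iff_add_le (Or.inl (EReal.coe_ne_bot r))
        (Or.inl (EReal.coe_ne_top r))).symm
    simp only [hP, hD, hiff, hLC, Set.mem_ofPred_eq] at hl ⊢
    obtain ⟨⟨hconc, k, hk, hlip⟩, hl0, hlu⟩ := hl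
    obtain ⟨m, hlm, hmc, hmlip, hm0, hmu, hmax⟩ :=
      exists_maximal_concave_lipschitz _ hconc hlip hl0 hlu
    exact ⟨m, ⟨⟨⟨hmc, k, hk, hmlip⟩, hm0, hmu⟩,
      fun n hn hmn => hmax n hn.1.1 hn.2.1 hn.2.2 hmn⟩, hlm⟩
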